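/- Let x = x_R be the relativistic map x_R(y) = −e^{−y} and let f be a normalized outgoing wave function. Then for every β > 0 the extra-particle integral ∫_0^∞ (|F̌(k)|² + |F̌(−k)|²)/(2k(e^{βk} − 1)) dk is infinite; in particular the mean number of particles stimulated by an incoming thermal state, N̄^Th_{β,in}[f], is infinite for every β > 0, even when the spontaneous number N̄_o[f] is finite. -/

import Mathlib

open MeasureTheory Set Filter
open scoped ENNReal

/-- The Fourier transform `f̂(p) = (2π)^{-1/2} ∫ f(y) e^{-ipy} dy`. -/
noncomputable def ft (f : ℝ → ℂ) (p : ℝ) : ℂ :=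
  (Real.sqrt (2 * Real.pi) : ℂ)⁻¹ *
    ∫ y : ℝ, f y * Complex.exp (-Complex.I * (p : ℂ) * (y : ℂ))

/-- `F̌(k) = (2π)^{-1/2} ∫ f(y) e^{-ik x(y)} dy`. -/
noncomputable def Fk (x : ℝ → ℝ) (f : ℝ → ℂ) (k : ℝ) : ℂ :=
  (Real.sqrt (2 * Real.pi) : ℂ)⁻¹ *
    ∫ y : ℝ, f y * Complex.exp (-Complex.I * (k : ℂ) * (x y : ℂ))

/-- The relativistic black-hole coordinate map `x_R(y) = -e^{-y}`. -/
noncomputable def xR (y : ℝ) : ℝ := -Real.exp (-y)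

/-- The CGHS black-hole coordinate map `x_C(y) = -log(1+e^{-y})`. -/
noncomputable def xC (y : ℝ) : ℝ := -Real.log (1 + Real.exp (-y))

/-- The mean number of spontaneously created particles `N̄_o[f]`. -/
noncomputable def No (x : ℝ → ℝ) (f : ℝ → ℂ) : ℝ≥0∞ :=
  ∫⁻ k in Set.Ioi (0:ℝ), ENNReal.ofReal (‖Fk x f (-k)‖ ^ 2 / (2 * k))

/-- The thermal mean particle number `N̄^Th_β[f]` at inverse temperature `β`. -/
noncomputable def Nth (β : ℝ) (f : ℝ → ℂ) : ℝ≥0∞ :=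
  ∫⁻ p in Set.Ioi (0:ℝ),
    ENNReal.ofReal (‖ft f p‖ ^ 2 / (2 * p * (Real.exp (β * p) - 1)))

/-- translate of `f` by `y₀`. -/
noncomputable def tr (f : ℝ → ℂ) (y₀ : ℝ) : ℝ → ℂ := fun y => f (y - y₀)

/-- The mean number of particles emitted when the incoming state is thermal at inverse
temperature `β`: `N̄^Th_{β,in}[f] = ∫_ℝ |F̌(k)|²/(2k(e^{βk}-1)) dk`. -/
noncomputable def NthIn (x : ℝ → ℝ) (β : ℝ) (f : ℝ → ℂ) : ℝ≥0∞ :=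
  ∫⁻ k : ℝ, ENNReal.ofReal (‖Fk x f k‖ ^ 2 / (2 * k * (Real.exp (β * k) - 1)))

open scoped FourierTransform Convolution Topology ComplexConjugate

/-- The primitive `x ↦ ∫_{-∞}^x g`. -/
noncomputable def primitiveIic (g : ℝ → ℂ) (x : ℝ) : ℂ := ∫ t in Iic x, g t

/-- The moving integral `x ↦ ∫_{x-δ}^x g`. -/
noncomputable def movingIntegral (δ : ℝ) (g : ℝ → ℂ) (x : ℝ) : ℂ :=
  primitiveIic g x - primitiveIic g (x - δ)

/-- The indicator function of `[0, δ)`. -/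
noncomputable def boxFun (δ : ℝ) : ℝ → ℂ := (Ico 0 δ).indicator 1

lemma integrable_boxFun (δ : ℝ) : Integrable (boxFun δ) :=
  (integrable_indicator_iff measurableSet_Ico).2 (integrableOn_const (by simp))

lemma movingIntegral_eq_convolution {g : ℝ → ℂ} (hg : Integrable g) {δ : ℝ} (hδ : 0 ≤ δ) :
    movingIntegral δ g = g ⋆[ContinuousLinearMap.mul ℂ ℂ, volume] boxFun δ := by
  ext x
  rw [movingIntegral, primitiveIic, primitiveIic,
    intervalIntegral.integral_Iic_sub_Iic hg.integrableOn hg.integrableOn,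
    intervalIntegral.integral_of_le (by linarith), ← integral_indicator measurableSet_Ioc,
    convolution_def]
  congr 1
  ext t
  by_cases h : t ∈ Ioc (x - δ) x
  · have h' : x - t ∈ Ico 0 δ := ⟨by linarith [h.2], by linarith [h.1]⟩
    simp [boxFun, h, h']
  · have h' : x - t ∉ Ico 0 δ := fun h' => h ⟨by linarith [h'.2], by linarith [h'.1]⟩
    simp [boxFun, h, h']

lemma integrable_movingIntegral {g : ℝ → ℂ} (hg : Integrable g) {δ : ℝ} (hδ : 0 ≤ δ) :
    Integrable (movingIntegral δ g) := by
  rw [movingIntegral_eq_convolution hg hδ]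
  exact hg.integrable_convolution _ (integrable_boxFun δ)

lemma continuous_primitiveIic {g : ℝ → ℂ} (hg : Integrable g) : Continuous (primitiveIic g) := by
  have h : primitiveIic g = fun x => primitiveIic g 0 + ∫ t in (0 : ℝ)..x, g t := by
    ext x
    rw [← intervalIntegral.integral_Iic_sub_Iic hg.integrableOn hg.integrableOn]
    simp [primitiveIic]
  rw [h]
  exact continuous_const.add (hg.continuous_primitive 0)

lemma continuous_movingIntegral {g : ℝ → ℂ} (hg : Integrable g) (δ : ℝ) :
    Continuous (movingIntegral δ g) :=
  (continuous_primitiveIic hg).sub ((continuous_primitiveIic hg).comp (by fun_prop))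

lemma norm_primitiveIic_le {g : ℝ → ℂ} (hg : Integrable g) (x : ℝ) :
    ‖primitiveIic g x‖ ≤ ∫ t, ‖g t‖ :=
  (norm_integral_le_integral_norm _).trans
    (setIntegral_le_integral hg.norm (Eventually.of_forall fun _ => norm_nonneg _))

lemma norm_movingIntegral_le {g : ℝ → ℂ} (hg : Integrable g) (δ x : ℝ) :
    ‖movingIntegral δ g x‖ ≤ 2 * ∫ t, ‖g t‖ := by
  have h := norm_sub_le (primitiveIic g x) (primitiveIic g (x - δ))
  have := norm_primitiveIic_le hg x
  have := norm_primitiveIic_le hg (x - δ)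
  rw [movingIntegral]
  linarith

lemma fourier_boxFun {δ : ℝ} (hδ : 0 ≤ δ) (ξ : ℝ) :
    2 * Real.pi * Complex.I * ξ * 𝓕 (boxFun δ) ξ
      = 1 - Complex.exp (-2 * Real.pi * Complex.I * ξ * δ) := by
  rcases eq_or_ne ξ 0 with rfl | hξ
  · simp
  have hξ' : (ξ : ℂ) ≠ 0 := Complex.ofReal_ne_zero.2 hξ
  have hc : -2 * Real.pi * Complex.I * ξ ≠ 0 := by
    simp [Real.pi_ne_zero, hξ]
  have h : 𝓕 (boxFun δ) ξ = ∫ t in (0 : ℝ)..δ, Complex.exp (-2 * Real.pi * Complex.I * ξ * t) := by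
    rw [Real.fourier_eq', intervalIntegral.integral_of_le hδ, ← integral_Ico_eq_integral_Ioc,
      ← integral_indicator measurableSet_Ico]
    congr 1
    ext t
    by_cases h : t ∈ Ico 0 δ
    · simp only [boxFun, indicator_of_mem h, Pi.one_apply, smul_eq_mul, mul_one]
      congr 1
      simp
      ring
    · simp [boxFun, h]
  rw [h, integral_exp_mul_complex hc]
  field_simp
  simp

lemma fourier_movingIntegral {g : ℝ → ℂ} (hg : Integrable g) {δ : ℝ} (hδ : 0 ≤ δ) (ξ : ℝ) :
    𝓕 (movingIntegral δ g) ξ = 𝓕 g ξ * 𝓕 (boxFun δ) ξ := by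
  rw [movingIntegral_eq_convolution hg hδ]
  exact Real.fourier_mul_convolution_eq hg (integrable_boxFun δ) ξ

lemma norm_fourier_movingIntegral_le {g : ℝ → ℂ} (hg : Integrable g) {δ : ℝ} (hδ : 0 ≤ δ)
    {ξ : ℝ} (hξ : ξ ≠ 0) : ‖𝓕 (movingIntegral δ g) ξ‖ ^ 2 ≤ ‖𝓕 g ξ‖ ^ 2 / ξ ^ 2 := by
  have h := congrArg norm (fourier_boxFun hδ ξ)
  have h2 : ‖1 - Complex.exp (-2 * Real.pi * Complex.I * ξ * δ)‖ ≤ 2 := by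
    refine (norm_sub_le _ _).trans ?_
    rw [Complex.norm_exp]
    simp
    norm_num
  rw [← h] at h2
  have h3 : |ξ| * ‖𝓕 (boxFun δ) ξ‖ ≤ 1 := by
    simp only [norm_mul, Complex.norm_I, Complex.norm_real, Real.norm_eq_abs, mul_one,
      abs_of_pos Real.pi_pos, Complex.norm_ofNat] at h2
    have := Real.pi_gt_three
    have h0 : 0 ≤ |ξ| * ‖𝓕 (boxFun δ) ξ‖ := by positivity
    nlinarith
  rw [fourier_movingIntegral hg hδ, norm_mul, mul_pow, le_div_iff₀ (by positivity), mul_assoc,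
    ← sq_abs ξ, ← mul_pow, mul_comm ‖𝓕 (boxFun δ) ξ‖]
  exact mul_le_of_le_one_right (by positivity) (pow_le_one₀ (by positivity) h3)

lemma fourier_conj_neg (w : ℝ → ℂ) (ξ : ℝ) :
    𝓕 (fun x => conj (w (-x))) ξ = conj (𝓕 w ξ) := by
  rw [Real.fourier_eq', Real.fourier_eq', ← integral_conj, ← integral_neg_eq_self]
  congr 1
  ext t
  have h2 : conj (2 : ℂ) = 2 := map_ofNat _ 2
  simp [← Complex.exp_conj, h2]

/-- Plancherel's identity for bounded continuous integrable functions whose Fourier transform is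
square integrable. -/
lemma integral_norm_sq_eq_integral_norm_fourier_sq {w : ℝ → ℂ} (hw : Integrable w)
    (hc : Continuous w) {C : ℝ} (hC : ∀ x, ‖w x‖ ≤ C) (hF : Integrable fun ξ => ‖𝓕 w ξ‖ ^ 2) :
    ∫ x, ‖w x‖ ^ 2 = ∫ ξ, ‖𝓕 w ξ‖ ^ 2 := by
  set v : ℝ → ℂ := fun x => conj (w (-x)) with hv
  have hvi : Integrable v :=
    (LinearIsometryEquiv.integrable_comp_iff Complex.conjLIE).2 hw.comp_neg
  set A : ℝ → ℂ := v ⋆[ContinuousLinearMap.mul ℂ ℂ, volume] w with hA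
  have hAi : Integrable A := hvi.integrable_convolution _ hw
  have hAc : Continuous A := by
    refine BddAbove.continuous_convolution_right_of_integrable _ ?_ hvi hc
    exact ⟨C, by rintro _ ⟨x, rfl⟩; exact hC x⟩
  have hAF : 𝓕 A = fun ξ => ((‖𝓕 w ξ‖ ^ 2 : ℝ) : ℂ) := by
    ext ξ
    rw [hA, Real.fourier_mul_convolution_eq hvi hw, hv, fourier_conj_neg, Complex.conj_mul']
    simp
  have h0 : 𝓕⁻ (𝓕 A) 0 = A 0 := by
    rw [hAc.fourierInv_fourier_eq hAi (by rw [hAF]; exact hF.ofReal)]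
  rw [hAF, Real.fourierInv_eq', hA, convolution_def,
    ← integral_neg_eq_self fun t => (ContinuousLinearMap.mul ℂ ℂ) (v t) (w (0 - t))] at h0
  have h1 : ((∫ x, ‖w x‖ ^ 2 : ℝ) : ℂ) = ((∫ ξ, ‖𝓕 w ξ‖ ^ 2 : ℝ) : ℂ) := by
    rw [← integral_complex_ofReal, ← integral_complex_ofReal]
    simpa [hv, Complex.conj_mul'] using h0.symm
  exact_mod_cast h1

/-- If `ĝ(ξ)/ξ` is square integrable, then so is the primitive of `g`. -/
lemma lintegral_primitiveIic_sq_lt_top {g : ℝ → ℂ} (hg : Integrable g)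
    (h : Integrable fun ξ => ‖𝓕 g ξ‖ ^ 2 / ξ ^ 2) :
    ∫⁻ x, ENNReal.ofReal (‖primitiveIic g x‖ ^ 2) < ⊤ := by
  have hb : ∀ n : ℕ, ∫⁻ x, ENNReal.ofReal (‖movingIntegral n g x‖ ^ 2) ≤
      ENNReal.ofReal (∫ ξ, ‖𝓕 g ξ‖ ^ 2 / ξ ^ 2) := by
    intro n
    have hn : (0 : ℝ) ≤ n := n.cast_nonneg
    have hi := integrable_movingIntegral hg hn
    have hc := continuous_movingIntegral hg n
    have hae : ∀ᵐ ξ : ℝ, ‖𝓕 (movingIntegral n g) ξ‖ ^ 2 ≤ ‖𝓕 g ξ‖ ^ 2 / ξ ^ 2 := by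
      filter_upwards [Measure.ae_ne volume (0 : ℝ)] with ξ hξ
      exact norm_fourier_movingIntegral_le hg hn hξ
    have hFc : Continuous (𝓕 (movingIntegral n g)) :=
      VectorFourier.fourierIntegral_continuous Real.continuous_fourierChar (by fun_prop) hi
    have hFi : Integrable fun ξ => ‖𝓕 (movingIntegral n g) ξ‖ ^ 2 := by
      refine h.mono' (by fun_prop) ?_
      filter_upwards [hae] with ξ hξ
      rwa [Real.norm_of_nonneg (by positivity)]
    have hsq : Integrable fun x => ‖movingIntegral n g x‖ ^ 2 := by
      refine (hi.norm.const_mul (2 * ∫ t, ‖g t‖)).mono' (by fun_prop) (Eventually.of_forall ?_)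
      intro x
      rw [Real.norm_of_nonneg (by positivity), sq]
      exact mul_le_mul_of_nonneg_right (norm_movingIntegral_le hg _ _) (norm_nonneg _)
    rw [← ofReal_integral_eq_lintegral_ofReal hsq (Eventually.of_forall fun _ => by positivity),
      integral_norm_sq_eq_integral_norm_fourier_sq hi hc (norm_movingIntegral_le hg n) hFi]
    exact ENNReal.ofReal_le_ofReal (integral_mono_ae hFi h hae)
  have hlim : ∀ x, Tendsto (fun n : ℕ => ENNReal.ofReal (‖movingIntegral n g x‖ ^ 2)) atTop
      (𝓝 (ENNReal.ofReal (‖primitiveIic g x‖ ^ 2))) := by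
    intro x
    have h1 : Tendsto (fun n : ℕ => primitiveIic g (x - n)) atTop (𝓝 0) := by
      have : Tendsto (fun n : ℕ => x - (n : ℝ)) atTop atBot :=
        tendsto_atBot_add_const_left _ _
          (tendsto_neg_atTop_atBot.comp tendsto_natCast_atTop_atTop)
      exact tendsto_integral_Iic_zero this
    have h2 := (tendsto_const_nhds (x := primitiveIic g x)).sub h1
    rw [sub_zero] at h2
    exact ENNReal.tendsto_ofReal (h2.norm.pow 2)
  calc ∫⁻ x, ENNReal.ofReal (‖primitiveIic g x‖ ^ 2)
      = ∫⁻ x, liminf (fun n : ℕ => ENNReal.ofReal (‖movingIntegral n g x‖ ^ 2)) atTop := by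
        congr 1; ext x; exact (hlim x).liminf_eq.symm
    _ ≤ liminf (fun n : ℕ => ∫⁻ x, ENNReal.ofReal (‖movingIntegral n g x‖ ^ 2)) atTop := by
        refine lintegral_liminf_le fun n => ?_
        have := continuous_movingIntegral hg n
        fun_prop
    _ ≤ liminf (fun _ : ℕ => ENNReal.ofReal (∫ ξ, ‖𝓕 g ξ‖ ^ 2 / ξ ^ 2)) atTop :=
        liminf_le_liminf (Eventually.of_forall hb)
    _ < ⊤ := by simp

/-- A function continuous on a closed vertical strip, holomorphic in its interior and vanishing on
the lower half of the boundary line `Re s = 0` vanishes on all of that line. -/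
lemma eq_zero_of_strip {F : ℂ → ℂ} {b : ℝ} (hb : 0 < b)
    (hc : ContinuousOn F {s | 0 ≤ s.re ∧ s.re ≤ b})
    (hd : DifferentiableOn ℂ F {s | 0 < s.re ∧ s.re < b})
    (h0 : ∀ p : ℝ, p < 0 → F (p * Complex.I) = 0) (p : ℝ) : F (p * Complex.I) = 0 := by
  set S : Set ℂ := {s | 0 < s.re ∧ s.re < b} with hS
  have hSo : IsOpen S :=
    (isOpen_lt continuous_const Complex.continuous_re).inter
      (isOpen_lt Complex.continuous_re continuous_const)
  have hSc : Convex ℝ S :=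
    (convex_halfSpace_re_gt 0).inter (convex_halfSpace_re_lt b)
  have hFa : AnalyticOnNhd ℂ F S := hd.analyticOnNhd hSo
  set r : ℝ := min (b / 4) (1 / 2) with hr
  have hr0 : 0 < r := by positivity
  have hrb : r ≤ b / 4 := min_le_left _ _
  have hr1 : r ≤ 1 / 2 := min_le_right _ _
  set c : ℂ := r - Complex.I with hcdef
  have hcre : c.re = r := by simp [hcdef]
  have hcim : c.im = -1 := by simp [hcdef]
  set Q : Set ℂ := Ioo (-r) r ×ℂ Ioo (-r) r with hQ
  have hQcl : closure Q = Icc (-r) r ×ℂ Icc (-r) r := by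
    rw [hQ, Complex.closure_reProdIm, closure_Ioo (by linarith)]
  have hQo : IsOpen Q := isOpen_Ioo.reProdIm isOpen_Ioo
  have hQb : Bornology.IsBounded Q :=
    (Metric.isBounded_Ioo _ _).reProdIm (Metric.isBounded_Ioo _ _)
  have hdc : ∀ u : ℂ, (∀ w ∈ Q, u * w ∈ Q) → DiffContOnCl ℂ (fun w => F (c + u * w)) Q := by
    intro u hu
    have hu' : ∀ w ∈ closure Q, u * w ∈ closure Q := fun w hw =>
      map_mem_closure (f := fun w => u * w) (by fun_prop) hw hu
    refine ⟨hd.comp (by fun_prop) fun w hw => ?_, hc.comp (by fun_prop) fun w hw => ?_⟩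
    · have := hu w hw
      rw [hQ, Complex.mem_reProdIm] at this
      simp only [hS, mem_ofPred_eq, Complex.add_re, hcre]
      exact ⟨by linarith [this.1.1], by linarith [this.1.2]⟩
    · have := hu' w hw
      rw [hQcl, Complex.mem_reProdIm] at this
      simp only [mem_ofPred_eq, Complex.add_re, hcre]
      exact ⟨by linarith [this.1.1], by linarith [this.1.2]⟩
  have hedge : ∀ w : ℂ, w.re = -r → w.im ∈ Icc (-r) r → F (c + w) = 0 := by
    intro w hw1 hw2
    have : c + w = ((-1 + w.im : ℝ) : ℂ) * Complex.I := by
      apply Complex.ext <;> simp [hcre, hcim, hw1]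
    rw [this]
    exact h0 _ (by linarith [hw2.2])
  set P : ℂ → ℂ := fun w =>
    F (c + 1 * w) * F (c + (-1) * w) * (F (c + Complex.I * w) * F (c + (-Complex.I) * w)) with hP
  have hPd : DiffContOnCl ℂ P Q := by
    have hmul : ∀ {f g : ℂ → ℂ}, DiffContOnCl ℂ f Q → DiffContOnCl ℂ g Q →
        DiffContOnCl ℂ (fun w => f w * g w) Q := fun hf hg => ⟨hf.1.mul hg.1, hf.2.mul hg.2⟩
    refine hmul (hmul (hdc 1 ?_) (hdc (-1) ?_))
      (hmul (hdc Complex.I ?_) (hdc (-Complex.I) ?_)) <;>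
    · rintro w ⟨⟨h1, h2⟩, ⟨h3, h4⟩⟩
      simp only [hQ, Complex.mem_reProdIm, mem_Ioo]
      simp
      refine ⟨⟨?_, ?_⟩, ?_, ?_⟩ <;> linarith
  have hPf : EqOn P 0 (frontier Q) := by
    intro w hw
    rw [hQ, Complex.frontier_reProdIm, closure_Ioo (by linarith), frontier_Ioo (by linarith)] at hw
    simp only [hP, Pi.zero_apply, mul_eq_zero]
    rcases hw with ⟨h1, h2⟩ | ⟨h1, h2⟩
    · simp only [mem_preimage, mem_insert_iff, mem_singleton_iff, mem_Icc] at h1 h2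
      rcases h2 with h2 | h2
      · right; right
        exact hedge _ (by simp [h2]) (by simpa using ⟨by linarith [h1.2], by linarith [h1.1]⟩)
      · right; left
        exact hedge _ (by simp [h2]) (by simpa using ⟨by linarith [h1.1], by linarith [h1.2]⟩)
    · simp only [mem_preimage, mem_insert_iff, mem_singleton_iff, mem_Icc] at h1 h2
      rcases h1 with h1 | h1
      · left; left
        exact hedge _ (by simp [h1]) (by simpa using h2)
      · left; right
        exact hedge _ (by simp [h1]) (by simpa using ⟨by linarith [h2.2], by linarith [h2.1]⟩)
  have hPz : EqOn P 0 Q :=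
    Complex.eqOn_of_eqOn_frontier hQb hPd diffContOnCl_const hPf
  have hQ0 : Q ∈ 𝓝 (0 : ℂ) := hQo.mem_nhds (by
    simp [hQ, Complex.mem_reProdIm, hr0])
  have hcS : c ∈ S := by
    simp only [hS, mem_ofPred_eq, hcre]
    exact ⟨hr0, by linarith⟩
  have hnear : ∀ᶠ z in 𝓝 c, F z = 0 := by
    refine (hFa c hcS).eventually_eq_zero_or_eventually_ne_zero.resolve_right fun hne => ?_
    have key : ∀ u : ℂ, u ≠ 0 → ∀ᶠ w in 𝓝[≠] (0 : ℂ), F (c + u * w) ≠ 0 := by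
      intro u hu
      have ht : Tendsto (fun w : ℂ => c + u * w) (𝓝[≠] 0) (𝓝[≠] c) := by
        refine tendsto_nhdsWithin_iff.2 ⟨?_, ?_⟩
        · have : Tendsto (fun w : ℂ => c + u * w) (𝓝 0) (𝓝 (c + u * 0)) :=
            Continuous.tendsto (by fun_prop) 0
          rw [mul_zero, add_zero] at this
          exact this.mono_left nhdsWithin_le_nhds
        · filter_upwards [self_mem_nhdsWithin] with w hw
          simpa [hu] using hw
      exact ht.eventually hne
    have := (((key 1 one_ne_zero).and (key (-1) (by simp))).and
      ((key Complex.I Complex.I_ne_zero).and (key (-Complex.I) (by simp)))).and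
      (mem_nhdsWithin_of_mem_nhds hQ0)
    obtain ⟨w, ⟨⟨h1, h2⟩, h3, h4⟩, h5⟩ := this.exists
    exact (mul_ne_zero (mul_ne_zero h1 h2) (mul_ne_zero h3 h4)) (hPz h5)
  have hFS : EqOn F 0 S :=
    hFa.eqOn_zero_of_preconnected_of_eventuallyEq_zero hSc.isPreconnected hcS hnear
  have hseq : Tendsto (fun t : ℝ => F (t + p * Complex.I)) (𝓝[>] 0) (𝓝 (F (p * Complex.I))) := by
    have h1 : ContinuousWithinAt F {s | 0 ≤ s.re ∧ s.re ≤ b} (p * Complex.I) :=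
      hc _ (by simp [hb.le])
    refine h1.tendsto.comp (tendsto_nhdsWithin_iff.2 ⟨?_, ?_⟩)
    · have : Tendsto (fun t : ℝ => (t : ℂ) + p * Complex.I) (𝓝 0)
          (𝓝 (((0 : ℝ) : ℂ) + p * Complex.I)) := Continuous.tendsto (by fun_prop) 0
      rw [Complex.ofReal_zero, zero_add] at this
      exact this.mono_left nhdsWithin_le_nhds
    · filter_upwards [Ioo_mem_nhdsGT hb] with t ht
      simpa using ⟨ht.1.le, ht.2.le⟩
  refine tendsto_nhds_unique hseq ?_
  refine tendsto_const_nhds.congr' ?_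
  filter_upwards [Ioo_mem_nhdsGT hb] with t ht
  exact (hFS (by simpa [hS] using ht)).symm

/-- The two-sided Laplace integrand is dominated on the strip. -/
lemma norm_mul_exp_le {h : ℝ → ℂ} {b : ℝ} {s : ℂ} (h0 : 0 ≤ s.re) (hb : s.re ≤ b) (y : ℝ) :
    ‖h y * Complex.exp (-s * y)‖ ≤ ‖h y‖ + ‖(Real.exp (-b * y) : ℂ) * h y‖ := by
  rw [norm_mul, norm_mul, Complex.norm_exp, Complex.norm_real, Real.norm_of_nonneg (by positivity)]
  have h1 : Real.exp (-s * y : ℂ).re ≤ 1 + Real.exp (-b * y) := by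
    have : (-s * y : ℂ).re = -s.re * y := by simp
    rw [this]
    rcases le_total 0 y with hy | hy
    · have : Real.exp (-s.re * y) ≤ 1 := Real.exp_le_one_iff.2 (by nlinarith)
      linarith [Real.exp_pos (-b * y)]
    · have : Real.exp (-s.re * y) ≤ Real.exp (-b * y) := Real.exp_le_exp.2 (by nlinarith)
      linarith
  calc ‖h y‖ * Real.exp (-s * y : ℂ).re ≤ ‖h y‖ * (1 + Real.exp (-b * y)) := by gcongr
    _ = _ := by ring

lemma abs_mul_exp_le {a b ε y : ℝ} (hε : 0 < ε) (h1 : ε ≤ a) (h2 : a ≤ b - ε) :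
    |y| * Real.exp (-a * y) ≤ ε⁻¹ * (1 + Real.exp (-b * y)) := by
  have key : ε * |y| ≤ Real.exp (ε * |y|) := by linarith [Real.add_one_le_exp (ε * |y|)]
  have h3 : Real.exp (ε * |y|) * Real.exp (-a * y) ≤ 1 + Real.exp (-b * y) := by
    rw [← Real.exp_add]
    rcases le_total 0 y with hy | hy
    · rw [abs_of_nonneg hy]
      have : Real.exp (ε * y + -a * y) ≤ 1 := Real.exp_le_one_iff.2 (by nlinarith)
      linarith [Real.exp_pos (-b * y)]
    · rw [abs_of_nonpos hy]
      have : Real.exp (ε * -y + -a * y) ≤ Real.exp (-b * y) := Real.exp_le_exp.2 (by nlinarith)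
      linarith
  rw [inv_mul_eq_div, le_div_iff₀ hε]
  calc |y| * Real.exp (-a * y) * ε = ε * |y| * Real.exp (-a * y) := by ring
    _ ≤ Real.exp (ε * |y|) * Real.exp (-a * y) := by gcongr
    _ ≤ _ := h3

/-- If `h` and `e^{-by} h` are integrable and the Fourier transform of `h` vanishes on a half-line,
then it vanishes identically. -/
lemma fourier_eq_zero_of_exp_decay {h : ℝ → ℂ} {b : ℝ} (hb : 0 < b) (hi : Integrable h)
    (hbi : Integrable fun y => (Real.exp (-b * y) : ℂ) * h y) (h0 : ∀ ξ < 0, 𝓕 h ξ = 0) (ξ : ℝ) :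
    𝓕 h ξ = 0 := by
  set L : ℂ → ℂ := fun s => ∫ y : ℝ, h y * Complex.exp (-s * y) with hL
  have hLF : ∀ p : ℝ, L (p * Complex.I) = 𝓕 h (p / (2 * Real.pi)) := by
    intro p
    rw [Real.fourier_eq']
    refine integral_congr_ae (Eventually.of_forall fun y => ?_)
    simp only
    rw [smul_eq_mul, mul_comm]
    congr 2
    have := Real.pi_ne_zero
    simp
    field_simp
  have hbound := hi.norm.add hbi.norm
  have hmeas : ∀ s : ℂ, AEStronglyMeasurable (fun y : ℝ => h y * Complex.exp (-s * y)) volume :=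
    fun s => hi.aestronglyMeasurable.mul (by fun_prop)
  have hLc : ContinuousOn L {s | 0 ≤ s.re ∧ s.re ≤ b} := by
    refine continuousOn_of_dominated (fun s _ => hmeas s)
      (fun s hs => Eventually.of_forall fun y => norm_mul_exp_le hs.1 hs.2 y) hbound
      (Eventually.of_forall fun y => by fun_prop)
  have hLd : DifferentiableOn ℂ L {s | 0 < s.re ∧ s.re < b} := by
    rintro s ⟨hs0, hsb⟩
    obtain ⟨ε, hε, hε1, hε2⟩ : ∃ ε > 0, 2 * ε ≤ s.re ∧ 2 * ε ≤ b - s.re :=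
      ⟨min (s.re) (b - s.re) / 2, by have := sub_pos.2 hsb; positivity,
        by linarith [min_le_left s.re (b - s.re)], by linarith [min_le_right s.re (b - s.re)]⟩
    have := hasDerivAt_integral_of_dominated_loc_of_deriv_le (μ := volume) (𝕜 := ℂ)
      (F := fun s (y : ℝ) => h y * Complex.exp (-s * y))
      (F' := fun s (y : ℝ) => h y * (Complex.exp (-s * y) * -y))
      (bound := fun y => ε⁻¹ * (‖h y‖ + ‖(Real.exp (-b * y) : ℂ) * h y‖))
      (Metric.ball_mem_nhds s hε) (Eventually.of_forall hmeas)
      (hbound.mono' (hmeas s) (Eventually.of_forall fun y => norm_mul_exp_le hs0.le hsb.le y))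
      (hi.aestronglyMeasurable.mul (by fun_prop))
      (Eventually.of_forall fun y z hz => ?_) (hbound.const_mul _)
      (Eventually.of_forall fun y z hz => ?_)
    · exact this.2.differentiableAt.differentiableWithinAt
    · have hz' : |z.re - s.re| < ε := by
        have := (Complex.abs_re_le_norm (z - s)).trans_lt (by simpa [dist_eq_norm] using hz)
        simpa using this
      rw [abs_lt] at hz'
      have hm := abs_mul_exp_le (a := z.re) (b := b) (y := y) hε (by linarith) (by linarith)
      have hre : (-z * y : ℂ).re = -z.re * y := by simp
      rw [norm_mul, norm_mul, norm_mul, Complex.norm_exp, hre, norm_neg, Complex.norm_real,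
        Complex.norm_real, Real.norm_of_nonneg (Real.exp_pos _).le, Real.norm_eq_abs]
      calc ‖h y‖ * (Real.exp (-z.re * y) * |y|) = ‖h y‖ * (|y| * Real.exp (-z.re * y)) := by ring
        _ ≤ ‖h y‖ * (ε⁻¹ * (1 + Real.exp (-b * y))) := by gcongr
        _ = _ := by ring
    · have h1 : HasDerivAt (fun z : ℂ => -z * y) (-y) z := by
        simpa using (hasDerivAt_id z).neg.mul_const (y : ℂ)
      exact h1.cexp.const_mul _
  have h2 := eq_zero_of_strip hb hLc hLd
    (fun p hp => by
      rw [hLF]; exact h0 _ (div_neg_of_neg_of_pos hp (by positivity))) (ξ * (2 * Real.pi))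
  rw [hLF] at h2
  rwa [mul_div_cancel_right₀ _ (by positivity)] at h2

lemma hasDerivAt_xR (y : ℝ) : HasDerivAt xR (Real.exp (-y)) y := by
  simpa using! (hasDerivAt_neg y).exp.neg

lemma strictMono_xR : StrictMono xR := fun _ _ h =>
  neg_lt_neg (Real.exp_lt_exp.2 (neg_lt_neg h))

lemma xR_neg (y : ℝ) : xR y < 0 := neg_neg_of_pos (Real.exp_pos _)

lemma xR_neg_log {x : ℝ} (hx : x < 0) : xR (-Real.log (-x)) = x := by
  rw [xR, neg_neg, Real.exp_log (neg_pos.2 hx), neg_neg]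

lemma image_xR_univ : xR '' univ = Iio 0 := by
  ext x
  refine ⟨?_, fun hx => ⟨_, mem_univ _, xR_neg_log hx⟩⟩
  rintro ⟨y, -, rfl⟩
  exact xR_neg y

lemma image_xR_Iic (y : ℝ) : xR '' Iic y = Iic (xR y) := by
  ext x
  constructor
  · rintro ⟨z, hz, rfl⟩
    exact strictMono_xR.monotone hz
  · intro hx
    have hx0 : x < 0 := lt_of_le_of_lt hx (xR_neg y)
    refine ⟨_, ?_, xR_neg_log hx0⟩
    rw [mem_Iic, ← strictMono_xR.le_iff_le, xR_neg_log hx0]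
    exact hx

/-- The push-forward density of `f` under `xR`. -/
noncomputable def pushXR (f : ℝ → ℂ) : ℝ → ℂ :=
  (Iio 0).indicator fun x => (-x)⁻¹ • f (-Real.log (-x))

lemma abs_exp_smul_pushXR (f : ℝ → ℂ) (y : ℝ) :
    |Real.exp (-y)| • pushXR f (xR y) = f y := by
  rw [pushXR, indicator_of_mem (mem_Iio.2 (xR_neg y)), abs_of_pos (Real.exp_pos _), smul_smul]
  simp [xR]

lemma integrable_pushXR {f : ℝ → ℂ} (hf : Integrable f) : Integrable (pushXR f) := by
  have h := integrableOn_image_iff_integrableOn_abs_deriv_smul MeasurableSet.univ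
    (fun y _ => (hasDerivAt_xR y).hasDerivWithinAt) strictMono_xR.injective.injOn (pushXR f)
  simp only [abs_exp_smul_pushXR, image_xR_univ] at h
  have h2 : IntegrableOn (pushXR f) (Iio 0) := h.2 hf.integrableOn
  rwa [pushXR, integrableOn_indicator_iff measurableSet_Iio, inter_self,
    ← integrable_indicator_iff measurableSet_Iio] at h2

lemma primitiveIic_pushXR (f : ℝ → ℂ) (y : ℝ) :
    primitiveIic (pushXR f) (xR y) = primitiveIic f y := by
  have h := integral_image_eq_integral_abs_deriv_smul (measurableSet_Iic (a := y))
    (fun y _ => (hasDerivAt_xR y).hasDerivWithinAt) strictMono_xR.injective.injOn (pushXR f)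
  simpa only [abs_exp_smul_pushXR, image_xR_Iic, primitiveIic] using h

lemma Fk_xR_eq_fourier (f : ℝ → ℂ) (k : ℝ) :
    Fk xR f k = (Real.sqrt (2 * Real.pi) : ℂ)⁻¹ * 𝓕 (pushXR f) (k / (2 * Real.pi)) := by
  rw [Fk, Real.fourier_eq']
  congr 1
  have h := integral_image_eq_integral_abs_deriv_smul MeasurableSet.univ
    (fun y _ => (hasDerivAt_xR y).hasDerivWithinAt) strictMono_xR.injective.injOn
    (fun x => Complex.exp (-Complex.I * k * x) • pushXR f x)
  simp only [smul_comm (_ : ℝ) (_ : ℂ), abs_exp_smul_pushXR, image_xR_univ, setIntegral_univ] at h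
  rw [setIntegral_eq_integral_of_forall_compl_eq_zero
    (fun x hx => by simp [pushXR, indicator_of_notMem hx])] at h
  simp only [smul_eq_mul, mul_comm (Complex.exp _)] at h
  rw [← h]
  refine integral_congr_ae (Eventually.of_forall fun x => ?_)
  simp only
  rw [smul_eq_mul, mul_comm]
  congr 2
  have := Real.pi_ne_zero
  simp
  field_simp

lemma ft_eq_fourier (f : ℝ → ℂ) (p : ℝ) :
    ft f p = (Real.sqrt (2 * Real.pi) : ℂ)⁻¹ * 𝓕 f (p / (2 * Real.pi)) := by
  rw [ft, Real.fourier_eq']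
  congr 1
  refine integral_congr_ae (Eventually.of_forall fun x => ?_)
  simp only
  rw [smul_eq_mul, mul_comm]
  congr 2
  have := Real.pi_ne_zero
  simp
  field_simp

lemma continuous_fourier {g : ℝ → ℂ} (hg : Integrable g) : Continuous (𝓕 g) :=
  VectorFourier.fourierIntegral_continuous Real.continuous_fourierChar (by fun_prop) hg

lemma continuous_Fk_xR {f : ℝ → ℂ} (hf : Integrable f) : Continuous (Fk xR f) := by
  have h := continuous_fourier (integrable_pushXR hf)
  have : Fk xR f = fun k => (Real.sqrt (2 * Real.pi) : ℂ)⁻¹ * 𝓕 (pushXR f) (k / (2 * Real.pi)) :=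
    funext (Fk_xR_eq_fourier f)
  rw [this]
  fun_prop

lemma norm_Fk_le (x : ℝ → ℝ) (f : ℝ → ℂ) (k : ℝ) :
    ‖Fk x f k‖ ≤ ‖(Real.sqrt (2 * Real.pi) : ℂ)⁻¹‖ * ∫ y, ‖f y‖ := by
  rw [Fk, norm_mul]
  gcongr
  refine (norm_integral_le_integral_norm _).trans_eq ?_
  congr 1
  ext y
  rw [norm_mul, Complex.norm_exp]
  simp

/-- Finiteness of the extra-particle integral forces `F̌(k)/k` to be square integrable. -/
lemma integrable_Fk_sq_div_sq {f : ℝ → ℂ} (hf : Integrable f) {β : ℝ} (hβ : 0 < β)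
    (h : (∫⁻ k in Ioi (0 : ℝ), ENNReal.ofReal ((‖Fk xR f k‖ ^ 2 + ‖Fk xR f (-k)‖ ^ 2) /
      (2 * k * (Real.exp (β * k) - 1)))) ≠ ⊤) :
    Integrable fun k => ‖Fk xR f k‖ ^ 2 / k ^ 2 := by
  have hFc := continuous_Fk_xR hf
  set N : ℝ → ℝ := fun k => ‖Fk xR f k‖ ^ 2 + ‖Fk xR f (-k)‖ ^ 2 with hN
  have hNm : Measurable N := by fun_prop
  have hN0 : ∀ k, 0 ≤ N k := fun k => by positivity
  have hA : IntegrableOn (fun k => N k / (2 * k * (Real.exp (β * k) - 1))) (Ioi 0) := by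
    refine ⟨Measurable.aestronglyMeasurable (by fun_prop), ?_⟩
    rw [hasFiniteIntegral_iff_ofReal]
    · exact h.lt_top
    · filter_upwards [ae_restrict_mem measurableSet_Ioi] with k hk
      have hk : 0 < k := hk
      have : 0 < Real.exp (β * k) - 1 := sub_pos.2 (Real.one_lt_exp_iff.2 (by positivity))
      exact div_nonneg (hN0 k) (by positivity)
  have hsmall : IntegrableOn (fun k => N k / k ^ 2) (Ioc 0 1) := by
    refine Integrable.mono' ((hA.mono_set Ioc_subset_Ioi_self).const_mul (2 * β * Real.exp β))
      (Measurable.aestronglyMeasurable (by fun_prop)) ?_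
    filter_upwards [ae_restrict_mem measurableSet_Ioc] with k ⟨hk0, hk1⟩
    have h1 : Real.exp (β * k) - 1 ≤ β * k * Real.exp β := by
      have h2 : Real.exp (β * k) * (1 - β * k) ≤ 1 := by
        calc Real.exp (β * k) * (1 - β * k) ≤ Real.exp (β * k) * Real.exp (-(β * k)) := by
              gcongr; linarith [Real.add_one_le_exp (-(β * k))]
          _ = 1 := by rw [← Real.exp_add]; simp
      have h3 : Real.exp (β * k) ≤ Real.exp β := Real.exp_le_exp.2 (by nlinarith)
      have h4 : β * k * Real.exp (β * k) ≤ β * k * Real.exp β := by gcongr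
      linarith
    have h0 : 0 < Real.exp (β * k) - 1 := sub_pos.2 (Real.one_lt_exp_iff.2 (by positivity))
    rw [Real.norm_of_nonneg (div_nonneg (hN0 k) (sq_nonneg k)), ← mul_div_assoc,
      div_le_div_iff₀ (by positivity) (by positivity)]
    calc N k * (2 * k * (Real.exp (β * k) - 1)) ≤ N k * (2 * k * (β * k * Real.exp β)) := by
          gcongr
      _ = _ := by ring
  have hlarge : IntegrableOn (fun k => N k / k ^ 2) (Ioi 1) := by
    set M := ‖(Real.sqrt (2 * Real.pi) : ℂ)⁻¹‖ * ∫ y, ‖f y‖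
    have hr : IntegrableOn (fun k : ℝ => k ^ (-2 : ℝ)) (Ioi 1) :=
      integrableOn_Ioi_rpow_of_lt (by norm_num) one_pos
    refine Integrable.mono' (hr.const_mul (2 * M ^ 2))
      (Measurable.aestronglyMeasurable (by fun_prop)) ?_
    filter_upwards [ae_restrict_mem measurableSet_Ioi] with k hk
    have hk : 0 < k := one_pos.trans hk
    have h1 : N k ≤ 2 * M ^ 2 := by
      have h1 := pow_le_pow_left₀ (norm_nonneg _) (norm_Fk_le xR f k) 2
      have h2 := pow_le_pow_left₀ (norm_nonneg _) (norm_Fk_le xR f (-k)) 2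
      simp only [hN]
      linarith
    rw [Real.norm_of_nonneg (div_nonneg (hN0 k) (sq_nonneg k)), Real.rpow_neg hk.le,
      ← div_eq_mul_inv]
    norm_cast
    gcongr
  have hpos : IntegrableOn (fun k => N k / k ^ 2) (Ioi 0) := by
    rw [← Ioc_union_Ioi_eq_Ioi zero_le_one]
    exact hsmall.union hlarge
  have hneg : IntegrableOn (fun k => N k / k ^ 2) (Iio 0) := by
    have := hpos.comp_neg
    simpa [hN, add_comm] using this
  have hN1 : Integrable fun k => N k / k ^ 2 := by
    rw [← integrableOn_univ, ← Iic_union_Ioi (a := (0 : ℝ))]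
    exact ((integrableOn_Iic_iff_integrableOn_Iio (by simp)).2 hneg).union hpos
  refine hN1.mono' (Measurable.aestronglyMeasurable (by fun_prop))
    (Eventually.of_forall fun k => ?_)
  rw [Real.norm_of_nonneg (by positivity)]
  gcongr
  simp [hN]

lemma integrable_fourier_pushXR_sq_div_sq {f : ℝ → ℂ}
    (h : Integrable fun k => ‖Fk xR f k‖ ^ 2 / k ^ 2) :
    Integrable fun ξ => ‖𝓕 (pushXR f) ξ‖ ^ 2 / ξ ^ 2 := by
  have hpi : 2 * Real.pi ≠ 0 := by positivity
  have h1 := (h.comp_mul_left' hpi).const_mul ((2 * Real.pi) ^ 3)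
  refine h1.congr (Eventually.of_forall fun ξ => ?_)
  simp only [Fk_xR_eq_fourier, norm_mul, norm_inv, Complex.norm_real, Real.norm_eq_abs, mul_pow,
    mul_div_cancel_left₀ _ hpi, inv_pow, sq_abs, Real.sq_sqrt (by positivity : 0 ≤ 2 * Real.pi)]
  field_simp

/-- Finiteness of the extra-particle integral gives weighted square integrability of the
primitive of `f`. -/
lemma integrable_exp_mul_primitiveIic_sq {f : ℝ → ℂ} (hf : Integrable f)
    (h : Integrable fun k => ‖Fk xR f k‖ ^ 2 / k ^ 2) :
    Integrable fun y => Real.exp (-y) * ‖primitiveIic f y‖ ^ 2 := by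
  have h1 := lintegral_primitiveIic_sq_lt_top (integrable_pushXR hf)
    (integrable_fourier_pushXR_sq_div_sq h)
  have h2 := lintegral_image_eq_lintegral_abs_deriv_mul MeasurableSet.univ
    (fun y _ => (hasDerivAt_xR y).hasDerivWithinAt) strictMono_xR.injective.injOn
    (fun x => ENNReal.ofReal (‖primitiveIic (pushXR f) x‖ ^ 2))
  have h3 := continuous_primitiveIic hf
  refine ⟨by fun_prop, ?_⟩
  rw [hasFiniteIntegral_iff_ofReal (Eventually.of_forall fun y => by positivity)]
  simp only [primitiveIic_pushXR, abs_of_pos (Real.exp_pos _),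
    ← ENNReal.ofReal_mul (Real.exp_pos _).le, setLIntegral_univ] at h2
  rw [← h2]
  exact (setLIntegral_le_lintegral _ _).trans_lt h1

lemma integrable_exp_mul_movingIntegral {f : ℝ → ℂ} (hf : Integrable f)
    (h : Integrable fun y => Real.exp (-y) * ‖primitiveIic f y‖ ^ 2) {δ : ℝ} (hδ : 0 ≤ δ) :
    Integrable fun y => (Real.exp (-(1 / 4) * y) : ℂ) * movingIntegral δ f y := by
  have hc := continuous_primitiveIic hf
  have hm := continuous_movingIntegral hf δ
  have hφ : IntegrableOn (fun y => (Real.exp (-(1 / 4) * y) : ℂ) * primitiveIic f y) (Iic 0) := by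
    have he : IntegrableOn (fun y => Real.exp (1 / 2 * y)) (Iic 0) :=
      integrableOn_exp_mul_Iic (by norm_num) 0
    refine Integrable.mono' (h.integrableOn.add he) (by fun_prop) (Eventually.of_forall fun y => ?_)
    rw [norm_mul, Complex.norm_real, Real.norm_of_nonneg (Real.exp_pos _).le]
    have h1 : Real.exp (-y) = Real.exp (-(1 / 2) * y) ^ 2 := by rw [← Real.exp_nat_mul]; ring_nf
    have h2 : Real.exp (1 / 2 * y) = Real.exp (1 / 4 * y) ^ 2 := by
      rw [← Real.exp_nat_mul]; ring_nf
    have h3 : Real.exp (-(1 / 4) * y) = Real.exp (-(1 / 2) * y) * Real.exp (1 / 4 * y) := by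
      rw [← Real.exp_add]; ring_nf
    simp only [Pi.add_apply]
    rw [h1, h2, h3]
    have h4 := Real.exp_pos (-(1 / 2) * y)
    have h5 := Real.exp_pos (1 / 4 * y)
    nlinarith [sq_nonneg (Real.exp (-(1 / 2) * y) * ‖primitiveIic f y‖ - Real.exp (1 / 4 * y)),
      mul_nonneg (mul_nonneg h4.le h5.le) (norm_nonneg (primitiveIic f y))]
  have hφδ : IntegrableOn (fun y => (Real.exp (-(1 / 4) * y) : ℂ) * primitiveIic f (y - δ))
      (Iic 0) := by
    have h1 : IntegrableOn (fun y => (Real.exp (-(1 / 4) * (y - δ)) : ℂ) * primitiveIic f (y - δ))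
        (Iic δ) := by
      have := (integrable_indicator_iff measurableSet_Iic).2 hφ
      have := this.comp_sub_right δ
      refine ((integrable_indicator_iff measurableSet_Iic).1 (this.congr ?_))
      refine Eventually.of_forall fun y => ?_
      simp [indicator]
    refine ((h1.mono_set (Iic_subset_Iic.2 hδ)).const_mul (Real.exp (-(1 / 4) * δ) : ℂ)).congr
      (Eventually.of_forall fun y => ?_)
    simp only
    rw [← mul_assoc, ← Complex.ofReal_mul, ← Real.exp_add]
    ring_nf
  have hneg : IntegrableOn (fun y => (Real.exp (-(1 / 4) * y) : ℂ) * movingIntegral δ f y)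
      (Iic 0) := by
    refine (hφ.sub hφδ).congr (Eventually.of_forall fun y => ?_)
    simp only [movingIntegral, Pi.sub_apply]
    ring
  have hpos : IntegrableOn (fun y => (Real.exp (-(1 / 4) * y) : ℂ) * movingIntegral δ f y)
      (Ioi 0) := by
    refine Integrable.mono' (integrable_movingIntegral hf hδ).norm.integrableOn (by fun_prop) ?_
    filter_upwards [ae_restrict_mem measurableSet_Ioi] with y hy
    have hy : 0 < y := hy
    rw [norm_mul, Complex.norm_real, Real.norm_of_nonneg (Real.exp_pos _).le]
    exact mul_le_of_le_one_left (norm_nonneg _) (Real.exp_le_one_iff.2 (by linarith))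
  rw [← integrableOn_univ, ← Iic_union_Ioi (a := (0 : ℝ))]
  exact hneg.union hpos

/-- If the primitive of `f` is square integrable with weight `e^{-y}` and `f̂` vanishes on
`(-∞, 0)`, then `f̂` vanishes on `(0, ∞)`. -/
lemma fourier_eq_zero_of_integrable_exp_mul_sq {f : ℝ → ℂ} (hf : Integrable f)
    (h : Integrable fun y => Real.exp (-y) * ‖primitiveIic f y‖ ^ 2)
    (h0 : ∀ ξ < 0, 𝓕 f ξ = 0) {ξ : ℝ} (hξ : 0 < ξ) : 𝓕 f ξ = 0 := by
  set δ : ℝ := 1 / (2 * ξ) with hδdef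
  have hδ : 0 ≤ δ := by positivity
  have h1 : 𝓕 (movingIntegral δ f) ξ = 0 := by
    refine fourier_eq_zero_of_exp_decay (b := 1 / 4) (by norm_num)
      (integrable_movingIntegral hf hδ) (integrable_exp_mul_movingIntegral hf h hδ) ?_ ξ
    intro η hη
    rw [fourier_movingIntegral hf hδ, h0 η hη, zero_mul]
  rw [fourier_movingIntegral hf hδ] at h1
  refine (mul_eq_zero.1 h1).resolve_right fun hbox => ?_
  have h2 := fourier_boxFun hδ ξ
  have h3 : -2 * Real.pi * Complex.I * ξ * δ = -(Real.pi * Complex.I) := by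
    have : (ξ : ℂ) ≠ 0 := Complex.ofReal_ne_zero.2 hξ.ne'
    rw [hδdef]
    push_cast
    field_simp
  rw [hbox, h3, Complex.exp_neg, Complex.exp_pi_mul_I] at h2
  norm_num at h2

lemma fourier_eq_zero_of_ae_ft_eq_zero {f : ℝ → ℂ} (hf : Integrable f)
    (hfp : ∀ᵐ p : ℝ, p ≤ 0 → ft f p = 0) : ∀ ξ < 0, 𝓕 f ξ = 0 := by
  have hpi : 0 < 2 * Real.pi := by positivity
  have hc : Continuous (ft f) := by
    have := continuous_fourier hf
    rw [funext (ft_eq_fourier f)]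
    fun_prop
  have h1 : EqOn (ft f) 0 (Iio 0) := by
    refine Measure.eqOn_open_of_ae_eq (μ := volume) ?_ isOpen_Iio hc.continuousOn
      continuousOn_const
    filter_upwards [ae_restrict_of_ae hfp, ae_restrict_mem measurableSet_Iio] with p hp hp0
    exact hp (le_of_lt hp0)
  intro ξ hξ
  have h2 : ft f (ξ * (2 * Real.pi)) = 0 := h1 (mul_neg_of_neg_of_pos hξ hpi)
  rw [ft_eq_fourier, mul_div_cancel_right₀ _ hpi.ne'] at h2
  exact (mul_eq_zero.1 h2).resolve_left
    (inv_ne_zero (Complex.ofReal_ne_zero.2 (Real.sqrt_pos.2 hpi).ne'))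

/-- The thermal number dominates the extra-particle integral. -/
lemma lintegral_extra_le_NthIn {f : ℝ → ℂ} (hf : Integrable f) {β : ℝ} (hβ : 0 < β) :
    (∫⁻ k in Ioi (0 : ℝ), ENNReal.ofReal ((‖Fk xR f k‖ ^ 2 + ‖Fk xR f (-k)‖ ^ 2) /
      (2 * k * (Real.exp (β * k) - 1)))) ≤ NthIn xR β f := by
  have hFc := continuous_Fk_xR hf
  set A : ℝ → ℝ≥0∞ :=
    fun k => ENNReal.ofReal (‖Fk xR f k‖ ^ 2 / (2 * k * (Real.exp (β * k) - 1))) with hA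
  have hAm : Measurable A := by fun_prop
  have hneg : ∫⁻ k in Ioi (0 : ℝ), A (-k) = ∫⁻ k in Iio (0 : ℝ), A k := by
    have := (Measure.measurePreserving_neg (volume : Measure ℝ)).setLIntegral_comp_preimage
      (measurableSet_Iio (a := (0 : ℝ))) hAm
    simpa using this
  calc _ ≤ ∫⁻ k in Ioi (0 : ℝ), (A k + A (-k)) := by
        refine setLIntegral_mono (by fun_prop) fun k hk => ?_
        have hk : 0 < k := hk
        have h0 : 0 < Real.exp (β * k) - 1 := sub_pos.2 (Real.one_lt_exp_iff.2 (by positivity))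
        have h1 : Real.exp (β * -k) < 1 := by
          rw [Real.exp_lt_one_iff]
          nlinarith
        rw [add_div, ENNReal.ofReal_add (by positivity) (by positivity)]
        refine add_le_add le_rfl (ENNReal.ofReal_le_ofReal ?_)
        have h2 : 2 * -k * (Real.exp (β * -k) - 1) = 2 * k * (1 - Real.exp (β * -k)) := by ring
        have h3 : 1 - Real.exp (β * -k) ≤ Real.exp (β * k) - 1 := by
          have := Real.add_one_le_exp (β * k)
          have := Real.add_one_le_exp (β * -k)
          linarith
        rw [h2]
        have h4 : 0 < 1 - Real.exp (β * -k) := by linarith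
        gcongr
    _ = (∫⁻ k in Iio (0 : ℝ), A k) + ∫⁻ k in Ioi (0 : ℝ), A k := by
        rw [lintegral_add_left hAm, hneg, add_comm]
    _ = ∫⁻ k in Iio (0 : ℝ) ∪ Ioi 0, A k := by
        refine (lintegral_union measurableSet_Ioi ?_).symm
        exact Set.disjoint_left.2 fun k h1 h2 => lt_asymm (mem_Iio.1 h1) (mem_Ioi.1 h2)
    _ ≤ NthIn xR β f := setLIntegral_le_lintegral _ _

/-- For the relativistic map `x_R` and a normalized outgoing wave
function `f`, the extra-particle integral
`∫_0^∞ (|F̌(k)|² + |F̌(-k)|²)/(2k(e^{βk}-1)) dk` is infinite for every `β > 0`;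
in particular `N̄^Th_{β,in}[f] = ∞` for every `β > 0`. -/
theorem stmt_17 (f : ℝ → ℂ) (hf : MeasureTheory.Integrable f)
    (hfp : ∀ᵐ p : ℝ, p ≤ 0 → ft f p = 0)
    (hfn : (∫⁻ p in Set.Ioi (0:ℝ),
        ENNReal.ofReal (‖ft f p‖ ^ 2 / (2 * p))) = 1)
    (β : ℝ) (hβ : 0 < β) :
    (∫⁻ k in Set.Ioi (0:ℝ), ENNReal.ofReal
        ((‖Fk xR f k‖ ^ 2 + ‖Fk xR f (-k)‖ ^ 2) /
          (2 * k * (Real.exp (β * k) - 1)))) = ⊤ ∧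
    NthIn xR β f = ⊤ := by
  have hextra : (∫⁻ k in Set.Ioi (0:ℝ), ENNReal.ofReal
        ((‖Fk xR f k‖ ^ 2 + ‖Fk xR f (-k)‖ ^ 2) /
          (2 * k * (Real.exp (β * k) - 1)))) = ⊤ := by
    by_contra h
    have h1 := integrable_exp_mul_primitiveIic_sq hf (integrable_Fk_sq_div_sq hf hβ h)
    have h2 : (∫⁻ p in Set.Ioi (0:ℝ), ENNReal.ofReal (‖ft f p‖ ^ 2 / (2 * p))) = 0 := by
      refine setLIntegral_eq_zero measurableSet_Ioi fun p hp => ?_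
      have hp : 0 < p := hp
      rw [ft_eq_fourier, fourier_eq_zero_of_integrable_exp_mul_sq hf h1
        (fourier_eq_zero_of_ae_ft_eq_zero hf hfp) (by positivity)]
      simp
    rw [h2] at hfn
    exact zero_ne_one hfn
  exact ⟨hextra, top_le_iff.1 (hextra ▸ lintegral_extra_le_NthIn hf hβ)⟩
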